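/- arXiv:2311.11886 — 4 statements merged into one kernel-verified Lean document; each statement's English description precedes it below -/
import Mathlib

section
/- Let s, a, z be complex numbers with Re s > 0, Re a > 0 and |z| < 1. Then the integral ∫₀^∞ x^{s−1} e^{−a x}/(1 − z e^{−x}) dx converges absolutely and ∑_{n=0}^∞ z^n/(a+n)^s = (1/Γ(s)) ∫₀^∞ x^{s−1} e^{−a x}/(1 − z e^{−x}) dx. -/
open Complex MeasureTheory Set

/-- The elementary majorant `x^(σ-1) e^(-αx)` is integrable on `(0, ∞)`. -/
lemma integrableOn_rpow_sub_one_mul_exp_neg_mul {σ α : ℝ} (hσ : 0 < σ) (hα : 0 < α) :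
    IntegrableOn (fun x : ℝ => x ^ (σ - 1) * Real.exp (-α * x)) (Ioi 0) := by
  simpa using integrableOn_rpow_mul_exp_neg_mul_rpow (p := 1) (s := σ - 1) (by linarith)
    one_pos hα

lemma norm_cpow_sub_one_mul_exp_neg_mul (s a : ℂ) {x : ℝ} (hx : 0 < x) :
    ‖(x : ℂ) ^ (s - 1) * Complex.exp (-a * x)‖ = x ^ (s.re - 1) * Real.exp (-a.re * x) := by
  rw [norm_mul, norm_cpow_eq_rpow_re_of_pos hx, Complex.norm_exp]
  simp

lemma norm_mul_exp_neg_le (z : ℂ) {x : ℝ} (hx : 0 < x) :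
    ‖z * Complex.exp (-x)‖ ≤ ‖z‖ := by
  rw [norm_mul, Complex.norm_exp]
  refine mul_le_of_le_one_right (norm_nonneg _) ?_
  simpa using hx.le

/-- The Laplace transform of `x^(s-1)` is holomorphic on the right half-plane. -/
lemma differentiableAt_integral_cpow_mul_exp_neg_mul {s r : ℂ} (hs : 0 < s.re) (hr : 0 < r.re) :
    DifferentiableAt ℂ
      (fun w : ℂ => ∫ x in Ioi (0 : ℝ), (x : ℂ) ^ (s - 1) * Complex.exp (-w * x)) r := by
  have hmem : {w : ℂ | r.re / 2 < w.re} ∈ nhds r :=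
    (isOpen_lt continuous_const Complex.continuous_re).mem_nhds (half_lt_self hr)
  refine (hasDerivAt_integral_of_dominated_loc_of_deriv_le (μ := volume.restrict (Ioi (0 : ℝ)))
    (F' := fun w x => (x : ℂ) ^ (s - 1) * (Complex.exp (-w * x) * (-x)))
    (bound := fun x => x ^ (s.re + 1 - 1) * Real.exp (-(r.re / 2) * x)) hmem
    (Filter.Eventually.of_forall fun w => Measurable.aestronglyMeasurable (by fun_prop)) ?_
    (Measurable.aestronglyMeasurable (by fun_prop)) ?_
    (integrableOn_rpow_sub_one_mul_exp_neg_mul (by linarith) (half_pos hr)) ?_).2.differentiableAt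
  · refine (integrableOn_rpow_sub_one_mul_exp_neg_mul hs hr).mono'
      (Measurable.aestronglyMeasurable (by fun_prop)) ?_
    filter_upwards [ae_restrict_mem measurableSet_Ioi] with x hx
    exact (norm_cpow_sub_one_mul_exp_neg_mul s r hx).le
  · filter_upwards [ae_restrict_mem measurableSet_Ioi] with x hx w hw
    have hx0 : (0 : ℝ) < x := hx
    have hw' : r.re / 2 < w.re := hw
    rw [← mul_assoc, norm_mul, norm_cpow_sub_one_mul_exp_neg_mul s w hx0, norm_neg,
      Complex.norm_of_nonneg hx0.le, add_sub_right_comm, Real.rpow_add_one hx0.ne', mul_right_comm]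
    gcongr
  · refine ae_of_all _ fun x w _ => ?_
    refine (HasDerivAt.cexp ?_).const_mul _
    simpa using ((hasDerivAt_id w).neg.mul_const (x : ℂ))

/-- The Gamma integral with a complex scaling parameter in the right half-plane. -/
lemma integral_cpow_mul_exp_neg_mul_Ioi_of_re_pos {s r : ℂ} (hs : 0 < s.re) (hr : 0 < r.re) :
    ∫ x in Ioi (0 : ℝ), (x : ℂ) ^ (s - 1) * Complex.exp (-r * x) =
      (r ^ s)⁻¹ * Complex.Gamma s := by
  have hopen : IsOpen {w : ℂ | 0 < w.re} := isOpen_lt continuous_const Complex.continuous_re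
  have hpre : IsPreconnected {w : ℂ | 0 < w.re} := (convex_halfSpace_re_gt 0).isPreconnected
  have hF : AnalyticOnNhd ℂ
      (fun w : ℂ => ∫ x in Ioi (0 : ℝ), (x : ℂ) ^ (s - 1) * Complex.exp (-w * x))
      {w : ℂ | 0 < w.re} :=
    DifferentiableOn.analyticOnNhd (fun w hw =>
      (differentiableAt_integral_cpow_mul_exp_neg_mul hs hw).differentiableWithinAt) hopen
  have hG : AnalyticOnNhd ℂ (fun w : ℂ => (w ^ s)⁻¹ * Complex.Gamma s) {w : ℂ | 0 < w.re} := by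
    refine DifferentiableOn.analyticOnNhd (fun w hw => ?_) hopen
    have hw0 : w ≠ 0 := by rintro rfl; simp at hw
    exact (((differentiableAt_id.cpow_const (Or.inl hw)).inv
      (by simp [Complex.cpow_eq_zero_iff, hw0])).mul_const _).differentiableWithinAt
  refine hF.eqOn_of_preconnected_of_frequently_eq hG hpre (z₀ := 1) (by simp) ?_ hr
  have hreal : ∀ t : ℝ, 0 < t →
      ∫ x in Ioi (0 : ℝ), (x : ℂ) ^ (s - 1) * Complex.exp (-(t : ℂ) * x) =
        ((t : ℂ) ^ s)⁻¹ * Complex.Gamma s := fun t ht => by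
    have key := Complex.integral_cpow_mul_exp_neg_mul_Ioi hs ht
    rw [one_div, Complex.inv_cpow _ _ (by simp [Complex.arg_ofReal_of_nonneg ht.le,
      Real.pi_ne_zero.symm])] at key
    simpa only [neg_mul] using key
  have htend : Filter.Tendsto (fun t : ℝ => (t : ℂ)) (nhdsWithin 1 {1}ᶜ) (nhdsWithin 1 {1}ᶜ) := by
    refine tendsto_nhdsWithin_of_tendsto_nhds_of_eventually_within _
      ((Complex.continuous_ofReal.tendsto' 1 1 (by simp)).mono_left nhdsWithin_le_nhds) ?_
    filter_upwards [self_mem_nhdsWithin] with t ht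
    simpa using ht
  refine htend.frequently (Filter.Eventually.frequently ?_)
  filter_upwards [nhdsWithin_le_nhds (lt_mem_nhds (zero_lt_one' ℝ))] with t ht
  exact hreal t ht

/-- The Laplace transform of `x^(s-1)` at `a + n`, scaled by `z^n`. -/
lemma integral_cpow_sub_one_mul_exp_mul_pow (s a z : ℂ) (hs : 0 < s.re) (ha : 0 < a.re) (n : ℕ) :
    ∫ x in Ioi (0 : ℝ), (x : ℂ) ^ (s - 1) * Complex.exp (-a * x) * (z * Complex.exp (-x)) ^ n =
      Complex.Gamma s * (z ^ n / (a + n) ^ s) := by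
  have hre : 0 < (a + n).re := by
    simpa using add_pos_of_pos_of_nonneg ha (Nat.cast_nonneg (α := ℝ) n)
  calc _ = ∫ x in Ioi (0 : ℝ), z ^ n * ((x : ℂ) ^ (s - 1) * Complex.exp (-(a + n) * x)) := by
        congr 1 with x
        rw [mul_pow, ← Complex.exp_nat_mul,
          show -(a + n) * (x : ℂ) = -a * x + n * (-x) by ring, Complex.exp_add]
        ring
    _ = _ := by
        rw [integral_const_mul, integral_cpow_mul_exp_neg_mul_Ioi_of_re_pos hs hre]
        ring

/-- For `Re s > 0`, `Re a > 0`, `|z| < 1`, the integral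
`∫₀^∞ x^(s-1) e^(-ax)/(1 - z e^(-x)) dx` converges absolutely and equals
`Γ(s) · ∑_{n=0}^∞ z^n/(a+n)^s`. -/
theorem lerch_integral_representation (s a z : ℂ) (hs : 0 < s.re) (ha : 0 < a.re)
    (hz : ‖z‖ < 1) :
    IntegrableOn
      (fun x : ℝ => (x : ℂ) ^ (s - 1) * Complex.exp (-a * x) / (1 - z * Complex.exp (-x)))
      (Ioi 0) ∧
    HasSum (fun n : ℕ => z ^ n / (a + n) ^ s)
      ((1 / Complex.Gamma s) *
        ∫ x in Ioi (0 : ℝ),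
          (x : ℂ) ^ (s - 1) * Complex.exp (-a * x) / (1 - z * Complex.exp (-x))) := by
  have hmaj := integrableOn_rpow_sub_one_mul_exp_neg_mul hs ha
  constructor
  · refine Integrable.mono' (hmaj.div_const (1 - ‖z‖))
      (Measurable.aestronglyMeasurable (by fun_prop)) ?_
    filter_upwards [ae_restrict_mem measurableSet_Ioi] with x hx
    rw [norm_div, norm_cpow_sub_one_mul_exp_neg_mul s a hx]
    have hx0 : (0 : ℝ) < x := hx
    have h1 : 1 - ‖z‖ ≤ ‖1 - z * Complex.exp (-x)‖ := by
      have h := norm_sub_norm_le (1 : ℂ) (z * Complex.exp (-x))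
      rw [norm_one] at h
      linarith [norm_mul_exp_neg_le z hx0]
    have h2 : 0 < 1 - ‖z‖ := by linarith
    gcongr
  · have h := hasSum_integral_of_dominated_convergence (μ := volume.restrict (Ioi (0 : ℝ)))
      (F := fun (n : ℕ) (x : ℝ) =>
        (x : ℂ) ^ (s - 1) * Complex.exp (-a * x) * (z * Complex.exp (-x)) ^ n)
      (f := fun x : ℝ =>
        (x : ℂ) ^ (s - 1) * Complex.exp (-a * x) / (1 - z * Complex.exp (-x)))
      (fun n x => x ^ (s.re - 1) * Real.exp (-a.re * x) * ‖z‖ ^ n)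
      (fun n => Measurable.aestronglyMeasurable (by fun_prop)) (fun n => ?_)
      (ae_of_all _ fun x => (summable_geometric_of_lt_one (norm_nonneg z) hz).mul_left _) ?_ ?_
    · simp only [integral_cpow_sub_one_mul_exp_mul_pow s a z hs ha] at h
      have hΓ := Complex.Gamma_ne_zero_of_re_pos hs
      simpa [hΓ] using h.mul_left (1 / Complex.Gamma s)
    · filter_upwards [ae_restrict_mem measurableSet_Ioi] with x hx
      have hx0 : (0 : ℝ) < x := hx
      rw [norm_mul, norm_cpow_sub_one_mul_exp_neg_mul s a hx, norm_pow]
      gcongr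
      exact norm_mul_exp_neg_le z hx0
    · simp only [tsum_mul_left]
      exact hmaj.mul_const _
    · filter_upwards [ae_restrict_mem measurableSet_Ioi] with x hx
      exact (hasSum_geometric_of_norm_lt_one
        ((norm_mul_exp_neg_le z hx).trans_lt hz)).mul_left _
end

section
/- Let a, s, z be complex numbers with Re a > 0, |z| < 1 and z ∉ [0,1) (so that −z avoids the cut (−∞,0]), and let c be a real number with max(−Re a, −1) < c < 0. Then the integral (1/2π) ∫_{−∞}^{∞} Γ(1+c+it) Γ(−c−it) (−z)^{c+it} / (a+c+it)^s dt converges absolutely and equals ∑_{n=0}^∞ z^n/(a+n)^s. -/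
open Complex MeasureTheory Set

open Filter Topology

/-- The Mellin–Barnes kernel `Γ(1+t) Γ(-t) = -π / sin (π t)`. -/
noncomputable def mellinBarnesKernel (t : ℂ) : ℂ :=
  Complex.Gamma (1 + t) * Complex.Gamma (-t)

theorem mellinBarnesKernel_eq (t : ℂ) :
    mellinBarnesKernel t = -(Real.pi : ℂ) / Complex.sin (Real.pi * t) := by
  have h := Complex.Gamma_mul_Gamma_one_sub (-t)
  rw [sub_neg_eq_add, mul_neg, Complex.sin_neg, mul_comm] at h
  rw [mellinBarnesKernel, h, div_neg, neg_div]

theorem mellinBarnesKernel_add_one (t : ℂ) :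
    mellinBarnesKernel (t + 1) = -mellinBarnesKernel t := by
  rw [mellinBarnesKernel_eq, mellinBarnesKernel_eq, mul_add, mul_one, Complex.sin_add_pi, div_neg]

theorem mul_mellinBarnesKernel {t : ℂ} (ht : t ≠ 0) :
    t * mellinBarnesKernel t = -(Complex.Gamma (1 + t) * Complex.Gamma (1 - t)) := by
  have h := Complex.Gamma_add_one (-t) (neg_ne_zero.2 ht)
  rw [show 1 - t = -t + 1 by ring, h, mellinBarnesKernel]
  ring

theorem Complex.differentiableAt_Gamma_of_re_pos {s : ℂ} (hs : 0 < s.re) :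
    DifferentiableAt ℂ Complex.Gamma s := by
  refine Complex.differentiableAt_Gamma s fun m h => ?_
  have : s.re = -(m : ℝ) := by simp [h]
  have : (0 : ℝ) ≤ m := m.cast_nonneg
  linarith

theorem differentiableAt_mellinBarnesKernel {t : ℂ} (h1 : -1 < t.re) (h2 : t.re < 0) :
    DifferentiableAt ℂ mellinBarnesKernel t := by
  have e1 : DifferentiableAt ℂ (fun t : ℂ => Complex.Gamma (1 + t)) t :=
    (Complex.differentiableAt_Gamma_of_re_pos (s := 1 + t) (by simp; linarith)).comp t
      (by fun_prop)
  have e2 : DifferentiableAt ℂ (fun t : ℂ => Complex.Gamma (-t)) t :=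
    (Complex.differentiableAt_Gamma_of_re_pos (s := -t) (by simp; linarith)).comp t
      (by fun_prop)
  exact e1.mul e2

theorem Real.exp_abs_div_two_le_cosh (y : ℝ) : Real.exp |y| / 2 ≤ Real.cosh y := by
  rw [← Real.cosh_abs, Real.cosh_eq]
  have := Real.exp_pos (-|y|)
  linarith

theorem Complex.sin_eq_ofReal_add_ofReal_mul_I (w : ℂ) :
    Complex.sin w = ↑(Real.sin w.re * Real.cosh w.im) + ↑(Real.cos w.re * Real.sinh w.im) * I := by
  rw [Complex.sin_eq]
  push_cast
  rfl

theorem Complex.abs_sin_re_mul_cosh_im_le_norm_sin (w : ℂ) :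
    |Real.sin w.re| * Real.cosh w.im ≤ ‖Complex.sin w‖ := by
  have h : (Complex.sin w).re = Real.sin w.re * Real.cosh w.im := by
    rw [Complex.sin_eq_ofReal_add_ofReal_mul_I, Complex.add_re, Complex.re_ofReal_mul, Complex.I_re,
      mul_zero, add_zero, Complex.ofReal_re]
  calc |Real.sin w.re| * Real.cosh w.im = |(Complex.sin w).re| := by
        rw [h, abs_mul, abs_of_pos (Real.cosh_pos _)]
    _ ≤ _ := Complex.abs_re_le_norm _

theorem Complex.abs_sinh_im_le_norm_sin (w : ℂ) : |Real.sinh w.im| ≤ ‖Complex.sin w‖ := by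
  refine abs_le_of_sq_le_sq ?_ (norm_nonneg _)
  rw [Complex.sin_eq_ofReal_add_ofReal_mul_I, Complex.sq_norm, Complex.normSq_add_mul_I]
  have h1 := Real.sin_sq_add_cos_sq w.re
  have h2 := Real.cosh_sq w.im
  nlinarith [sq_nonneg (Real.sin w.re)]

theorem norm_mellinBarnesKernel_le_of_re {x : ℝ} (hx : Real.sin (Real.pi * x) ≠ 0) (y : ℝ) :
    ‖mellinBarnesKernel (x + y * I)‖ ≤
      2 * Real.pi / |Real.sin (Real.pi * x)| * Real.exp (-(Real.pi * |y|)) := by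
  have h := Complex.abs_sin_re_mul_cosh_im_le_norm_sin (Real.pi * (x + y * I))
  rw [show ((Real.pi : ℂ) * (x + y * I)).re = Real.pi * x by simp,
    show ((Real.pi : ℂ) * (x + y * I)).im = Real.pi * y by simp] at h
  have hs := abs_pos.2 hx
  have hc := Real.exp_abs_div_two_le_cosh (Real.pi * y)
  rw [abs_mul, abs_of_pos Real.pi_pos] at hc
  rw [mellinBarnesKernel_eq, norm_div, norm_neg, Complex.norm_real, Real.norm_eq_abs,
    abs_of_pos Real.pi_pos, Real.exp_neg]
  have hE := Real.exp_pos (Real.pi * |y|)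
  calc _ ≤ Real.pi / (|Real.sin (Real.pi * x)| * (Real.exp (Real.pi * |y|) / 2)) := by
        refine div_le_div_of_nonneg_left Real.pi_pos.le (by positivity) (le_trans ?_ h)
        gcongr
    _ = _ := by field_simp

theorem norm_mellinBarnesKernel_le_of_im (x : ℝ) {y : ℝ} (hy : 1 ≤ |y|) :
    ‖mellinBarnesKernel (x + y * I)‖ ≤ 4 * Real.pi * Real.exp (-(Real.pi * |y|)) := by
  have h := Complex.abs_sinh_im_le_norm_sin (Real.pi * (x + y * I))
  rw [show ((Real.pi : ℂ) * (x + y * I)).im = Real.pi * y by simp] at h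
  rw [Real.abs_sinh, abs_mul, abs_of_pos Real.pi_pos] at h
  have hE := Real.exp_pos (Real.pi * |y|)
  have h3 : 3 ≤ Real.pi * |y| := by nlinarith [Real.pi_gt_three]
  have h2 : Real.exp (Real.pi * |y|) / 4 ≤ Real.sinh (Real.pi * |y|) := by
    rw [Real.sinh_eq]
    have := Real.add_one_le_exp (Real.pi * |y|)
    have : Real.exp (-(Real.pi * |y|)) ≤ 1 := Real.exp_le_one_iff.2 (by linarith)
    linarith
  rw [mellinBarnesKernel_eq, norm_div, norm_neg, Complex.norm_real, Real.norm_eq_abs,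
    abs_of_pos Real.pi_pos, Real.exp_neg]
  calc _ ≤ Real.pi / (Real.exp (Real.pi * |y|) / 4) :=
        div_le_div_of_nonneg_left Real.pi_pos.le (by positivity) (h2.trans h)
    _ = _ := by field_simp

theorem integrable_exp_neg_mul_abs {δ : ℝ} (hδ : 0 < δ) :
    Integrable fun y : ℝ => Real.exp (-(δ * |y|)) := by
  rw [← integrableOn_univ, ← Iic_union_Ioi (a := (0 : ℝ))]
  refine IntegrableOn.union ?_ ?_
  · refine (integrableOn_exp_mul_Iic hδ 0).congr_fun (fun y hy => ?_) measurableSet_Iic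
    simp [abs_of_nonpos (mem_Iic.1 hy)]
  · refine (integrableOn_exp_mul_Ioi (neg_lt_zero.2 hδ) 0).congr_fun (fun y hy => ?_)
      measurableSet_Ioi
    simp [abs_of_pos (mem_Ioi.1 hy)]

/-- Contour shift between two vertical lines for a function that is holomorphic on the closed
strip between them and decays exponentially there. -/
theorem integral_vertical_eq_of_strip {f : ℂ → ℂ} {p q C δ : ℝ} (hδ : 0 < δ) (hpq : p ≤ q)
    (hf : ∀ t : ℂ, t.re ∈ Icc p q → DifferentiableAt ℂ f t)
    (hb : ∀ x ∈ Icc p q, ∀ y : ℝ, 1 ≤ |y| →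
      ‖f (x + y * I)‖ ≤ C * Real.exp (-(δ * |y|)))
    (hp : Integrable fun y : ℝ => f (p + y * I)) (hq : Integrable fun y : ℝ => f (q + y * I)) :
    ∫ y : ℝ, f (p + y * I) = ∫ y : ℝ, f (q + y * I) := by
  have key : ∀ T : ℝ, (∫ y in -T..T, f (q + y * I)) - (∫ y in -T..T, f (p + y * I)) =
      I * ((∫ x in p..q, f (x + ((-T : ℝ) : ℂ) * I)) - ∫ x in p..q, f (x + (T : ℂ) * I)) := by
    intro T
    have h := Complex.integral_boundary_rect_eq_zero_of_differentiableOn f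
      (p + ((-T : ℝ) : ℂ) * I) (q + (T : ℂ) * I) (fun t ht => by
        refine (hf t ?_).differentiableWithinAt
        have := (Complex.mem_reProdIm.1 ht).1
        simpa [uIcc_of_le hpq] using this)
    simp only [Complex.add_re, Complex.add_im, Complex.ofReal_re, Complex.ofReal_im,
      Complex.mul_re, Complex.mul_im, Complex.I_re, Complex.I_im, mul_zero, mul_one, sub_zero,
      add_zero, zero_add, smul_eq_mul] at h
    linear_combination (-I) * h + ((∫ y in -T..T, f (q + y * I)) -
      (∫ y in -T..T, f (p + y * I))) * Complex.I_mul_I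
  have hlim : Tendsto (fun T : ℝ => C * Real.exp (-(δ * T)) * |q - p|) atTop (𝓝 0) := by
    have : Tendsto (fun T : ℝ => Real.exp (-(δ * T))) atTop (𝓝 0) :=
      Real.tendsto_exp_neg_atTop_nhds_zero.comp (tendsto_id.const_mul_atTop hδ)
    simpa using (this.const_mul C).mul_const |q - p|
  have hor : ∀ σ : ℝ, |σ| = 1 →
      Tendsto (fun T : ℝ => ∫ x in p..q, f (x + ((σ * T : ℝ) : ℂ) * I)) atTop (𝓝 0) := by
    intro σ hσ
    refine squeeze_zero_norm' ?_ hlim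
    filter_upwards [eventually_ge_atTop 1] with T hT
    refine intervalIntegral.norm_integral_le_of_norm_le_const fun x hx => ?_
    rw [uIoc_of_le hpq] at hx
    have habs : |σ * T| = T := by rw [abs_mul, hσ, one_mul, abs_of_pos (by linarith)]
    have := hb x (Ioc_subset_Icc_self hx) (σ * T) (by rw [habs]; exact hT)
    rwa [habs] at this
  have hR : Tendsto (fun T : ℝ => I * ((∫ x in p..q, f (x + ((-T : ℝ) : ℂ) * I)) -
      ∫ x in p..q, f (x + (T : ℂ) * I))) atTop (𝓝 0) := by
    have h1 := hor (-1) (by simp)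
    have h2 := hor 1 (by simp)
    simp only [neg_mul, one_mul] at h1 h2
    simpa using (h1.sub h2).const_mul I
  have hL := (intervalIntegral_tendsto_integral hq tendsto_neg_atTop_atBot tendsto_id).sub
    (intervalIntegral_tendsto_integral hp tendsto_neg_atTop_atBot tendsto_id)
  simp only [id] at hL
  have := tendsto_nhds_unique (hL.congr key) hR
  exact (sub_eq_zero.1 this).symm

theorem sin_pi_mul_ne_zero_of_mem_Ioo {x : ℝ} (hx : x ∈ Ioo (-1 : ℝ) 0) :
    Real.sin (Real.pi * x) ≠ 0 :=
  (Real.sin_neg_of_neg_of_neg_pi_lt (by nlinarith [hx.2, Real.pi_pos])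
    (by nlinarith [hx.1, Real.pi_pos])).ne

/-- On a line `Re t = x` with `-1 < x < 0` the kernel is integrable against continuous functions
of exponential growth less than `π`, with an explicit bound. -/
theorem integrable_mellinBarnesKernel_mul {x : ℝ} (hx : x ∈ Ioo (-1 : ℝ) 0) {h : ℝ → ℂ}
    (hh : Continuous h) {B θ : ℝ} (hθ : θ < Real.pi)
    (hB : ∀ y : ℝ, ‖h y‖ ≤ B * Real.exp (θ * |y|)) :
    Integrable (fun y : ℝ => mellinBarnesKernel (x + y * I) * h y) ∧
      ‖∫ y : ℝ, mellinBarnesKernel (x + y * I) * h y‖ ≤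
        (2 * Real.pi / |Real.sin (Real.pi * x)| *
          ∫ y : ℝ, Real.exp (-((Real.pi - θ) * |y|))) * B := by
  have hs := sin_pi_mul_ne_zero_of_mem_Ioo hx
  have hle : ∀ y : ℝ, ‖mellinBarnesKernel (x + y * I) * h y‖ ≤
      2 * Real.pi / |Real.sin (Real.pi * x)| * B * Real.exp (-((Real.pi - θ) * |y|)) := by
    intro y
    have hpos : 0 < |Real.sin (Real.pi * x)| := abs_pos.2 hs
    rw [norm_mul, show -((Real.pi - θ) * |y|) = -(Real.pi * |y|) + θ * |y| by ring, Real.exp_add]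
    calc _ ≤ (2 * Real.pi / |Real.sin (Real.pi * x)| * Real.exp (-(Real.pi * |y|))) *
          (B * Real.exp (θ * |y|)) := by
          have := norm_mellinBarnesKernel_le_of_re hs y
          have := hB y
          have := Real.pi_pos
          gcongr
      _ = _ := by ring
  have hint := (integrable_exp_neg_mul_abs (sub_pos.2 hθ)).const_mul
    (2 * Real.pi / |Real.sin (Real.pi * x)| * B)
  have hK : Continuous fun y : ℝ => mellinBarnesKernel (x + y * I) := by
    refine continuous_iff_continuousAt.2 fun y => ?_
    have := (differentiableAt_mellinBarnesKernel (t := x + y * I) (by simpa using hx.1)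
      (by simpa using hx.2)).continuousAt
    exact this.comp (f := fun y : ℝ => (x : ℂ) + y * I) (by fun_prop)
  refine ⟨hint.mono' (hK.mul hh).aestronglyMeasurable (.of_forall hle), ?_⟩
  refine (norm_integral_le_of_norm_le hint (.of_forall hle)).trans_eq ?_
  rw [integral_const_mul]
  ring

theorem integral_mellinBarnesKernel_neg_half :
    ∫ y : ℝ, mellinBarnesKernel (((-1 / 2 : ℝ) : ℂ) + y * I) = Real.pi := by
  have hint := (integrable_mellinBarnesKernel_mul (x := -1 / 2) (by norm_num)
    (h := fun _ => 1) continuous_const Real.pi_pos (B := 1) (by simp)).1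
  simp only [mul_one] at hint
  have hval : ∀ y : ℝ, mellinBarnesKernel (((-1 / 2 : ℝ) : ℂ) + y * I) =
      ((Real.pi / Real.cosh (Real.pi * y) : ℝ) : ℂ) := by
    intro y
    rw [mellinBarnesKernel_eq, show (Real.pi : ℂ) * (((-1 / 2 : ℝ) : ℂ) + y * I) =
      (Real.pi * y : ℂ) * I - Real.pi / 2 by push_cast; ring, Complex.sin_sub_pi_div_two,
      Complex.cos_mul_I, neg_div_neg_eq]
    push_cast
    rfl
  simp only [hval] at hint ⊢
  rw [integral_complex_ofReal]
  congr 1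
  have hint' : Integrable fun y : ℝ => Real.pi / Real.cosh (Real.pi * y) := by
    simpa only [RCLike.re_eq_complex_re, Complex.ofReal_re] using hint.re
  have hd : ∀ y : ℝ, HasDerivAt (fun y => 2 * Real.arctan (Real.exp (Real.pi * y)))
      (Real.pi / Real.cosh (Real.pi * y)) y := by
    intro y
    have h := (((hasDerivAt_id y).const_mul Real.pi).exp.arctan).const_mul 2
    refine h.congr_deriv ?_
    rw [Real.cosh_eq, Real.exp_neg, id]
    have := Real.exp_pos (Real.pi * y)
    field_simp
    ring
  have hbot : Tendsto (fun y => 2 * Real.arctan (Real.exp (Real.pi * y))) atBot (𝓝 0) := by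
    have h1 : Tendsto (fun y : ℝ => Real.exp (Real.pi * y)) atBot (𝓝 0) :=
      Real.tendsto_exp_atBot.comp (tendsto_id.const_mul_atBot Real.pi_pos)
    simpa using ((Real.continuous_arctan.tendsto 0).comp h1).const_mul 2
  have htop : Tendsto (fun y => 2 * Real.arctan (Real.exp (Real.pi * y))) atTop (𝓝 Real.pi) := by
    have h1 : Tendsto (fun y : ℝ => Real.exp (Real.pi * y)) atTop atTop :=
      Real.tendsto_exp_atTop.comp (tendsto_id.const_mul_atTop Real.pi_pos)
    have h2 := ((Real.tendsto_arctan_atTop.mono_right nhdsWithin_le_nhds).comp h1).const_mul 2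
    simpa [mul_div_cancel₀] using h2
  simpa using integral_of_hasDerivAt_of_tendsto hd hint' hbot htop

theorem integral_mellinBarnesKernel {x : ℝ} (hx : x ∈ Ioo (-1 : ℝ) 0) :
    ∫ y : ℝ, mellinBarnesKernel (x + y * I) = Real.pi := by
  have hint : ∀ u ∈ Ioo (-1 : ℝ) 0, Integrable fun y : ℝ => mellinBarnesKernel (u + y * I) := by
    intro u hu
    simpa using (integrable_mellinBarnesKernel_mul hu (h := fun _ => 1) continuous_const
      Real.pi_pos (B := 1) (by simp)).1
  have hshift : ∀ u ∈ Ioo (-1 : ℝ) 0, ∀ v ∈ Ioo (-1 : ℝ) 0, u ≤ v →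
      ∫ y : ℝ, mellinBarnesKernel (u + y * I) = ∫ y : ℝ, mellinBarnesKernel (v + y * I) := by
    intro u hu v hv huv
    exact integral_vertical_eq_of_strip Real.pi_pos huv
      (fun t ht => differentiableAt_mellinBarnesKernel (hu.1.trans_le ht.1) (ht.2.trans_lt hv.2))
      (fun x _ y hy => norm_mellinBarnesKernel_le_of_im x hy) (hint u hu) (hint v hv)
  have h2 : (-1 / 2 : ℝ) ∈ Ioo (-1 : ℝ) 0 := by constructor <;> norm_num
  rw [← integral_mellinBarnesKernel_neg_half]
  rcases le_total x (-1 / 2) with h | h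
  · exact hshift _ hx _ h2 h
  · exact (hshift _ h2 _ hx h).symm

/-- Moving the line of integration past the pole of the kernel at `0`. -/
theorem integral_mellinBarnesKernel_mul_add {H : ℂ → ℂ} {c p B θ : ℝ} (hc : c ∈ Ioo (-1 : ℝ) 0)
    (hp : p < c) (hH : ∀ t : ℂ, p < t.re → DifferentiableAt ℂ H t) (hθ0 : 0 ≤ θ)
    (hθ : θ < Real.pi)
    (hB : ∀ x ∈ Icc c (c + 1), ∀ y : ℝ, ‖H (x + y * I)‖ ≤ B * Real.exp (θ * |y|)) :
    (∫ y : ℝ, mellinBarnesKernel (c + y * I) * H (c + y * I)) +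
      (∫ y : ℝ, mellinBarnesKernel (c + y * I) * H (c + y * I + 1)) = 2 * Real.pi * H 0 := by
  have hcont : ∀ x ∈ Icc c (c + 1), Continuous fun y : ℝ => H (x + y * I) := by
    intro x hx
    refine continuous_iff_continuousAt.2 fun y => ?_
    exact (hH (x + y * I) (by simpa using hp.trans_le hx.1)).continuousAt.comp
      (f := fun y : ℝ => (x : ℂ) + y * I) (by fun_prop)
  have hc0 : c ∈ Icc c (c + 1) := ⟨le_rfl, by linarith⟩
  have hc1 : c + 1 ∈ Icc c (c + 1) := ⟨by linarith, le_rfl⟩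
  have hadd : ∀ y : ℝ, ((c + 1 : ℝ) : ℂ) + y * I = c + y * I + 1 := fun y => by push_cast; ring
  have hcont1 := hcont _ hc1
  have hB1 := hB _ hc1
  simp only [hadd] at hcont1 hB1
  have i0 := (integrable_mellinBarnesKernel_mul hc (hcont c hc0) hθ (hB c hc0)).1
  have i1 := (integrable_mellinBarnesKernel_mul hc hcont1 hθ hB1).1
  have iK : Integrable fun y : ℝ => mellinBarnesKernel (c + y * I) * H 0 :=
    (integrable_mellinBarnesKernel_mul hc (h := fun _ => H 0) continuous_const
      Real.pi_pos (B := ‖H 0‖) (by simp)).1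
  set g : ℂ → ℂ := fun t => -(Complex.Gamma (1 + t) * Complex.Gamma (1 - t)) * dslope H 0 t
    with hg
  have hg_eq : ∀ t : ℂ, t ≠ 0 → g t = mellinBarnesKernel t * (H t - H 0) := by
    intro t ht
    simp only [hg]
    rw [← mul_mellinBarnesKernel ht, dslope_of_ne _ ht, slope_def_field, sub_zero]
    field_simp
  have hline0 : ∀ y : ℝ, g (c + y * I) =
      mellinBarnesKernel (c + y * I) * H (c + y * I) - mellinBarnesKernel (c + y * I) * H 0 := by
    intro y
    rw [hg_eq _ fun h => hc.2.ne (by simpa using congrArg Complex.re h), mul_sub]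
  have hline1 : ∀ y : ℝ, g ((c + 1 : ℝ) + y * I) =
      mellinBarnesKernel (c + y * I) * H 0 -
        mellinBarnesKernel (c + y * I) * H (c + y * I + 1) := by
    intro y
    rw [hadd, hg_eq _ fun h => (show c + 1 ≠ 0 by linarith [hc.1])
      (by simpa using congrArg Complex.re h), mellinBarnesKernel_add_one]
    ring
  have hB0 : 0 ≤ B := by
    have := (norm_nonneg _).trans (hB c hc0 0)
    simpa using this
  have hpc : p < 0 := hp.trans hc.2
  have hU : IsOpen {t : ℂ | p < t.re} := isOpen_lt continuous_const Complex.continuous_re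
  have hds : DifferentiableOn ℂ (dslope H 0) {t : ℂ | p < t.re} :=
    (Complex.differentiableOn_dslope (hU.mem_nhds (by simpa using hpc))).2
      fun t ht => (hH t ht).differentiableWithinAt
  have hshift := integral_vertical_eq_of_strip (f := g) (p := c) (q := c + 1)
    (C := 4 * Real.pi * (B + ‖H 0‖)) (sub_pos.2 hθ) (by linarith) (fun t ht => by
      refine DifferentiableAt.mul (DifferentiableAt.neg (DifferentiableAt.mul ?_ ?_))
        (hds.differentiableAt (hU.mem_nhds (hp.trans_le ht.1)))
      · exact (Complex.differentiableAt_Gamma_of_re_pos (s := 1 + t)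
          (by simp; linarith [ht.1, hc.1])).comp t (by fun_prop)
      · exact (Complex.differentiableAt_Gamma_of_re_pos (s := 1 - t)
          (by simp; linarith [ht.2, hc.2])).comp t (by fun_prop))
    (fun x hx y hy => by
      have hne : (x : ℂ) + y * I ≠ 0 := fun h => by
        have : y = 0 := by simpa using congrArg Complex.im h
        norm_num [this] at hy
      rw [hg_eq _ hne, norm_mul,
        show -((Real.pi - θ) * |y|) = -(Real.pi * |y|) + θ * |y| by ring, Real.exp_add]
      have h1 := norm_mellinBarnesKernel_le_of_im x hy
      have h2 : ‖H (x + y * I) - H 0‖ ≤ (B + ‖H 0‖) * Real.exp (θ * |y|) := by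
        refine (norm_sub_le _ _).trans ?_
        rw [add_mul]
        refine add_le_add (hB x hx y) (le_mul_of_one_le_right (norm_nonneg _) ?_)
        exact Real.one_le_exp (by positivity)
      calc _ ≤ (4 * Real.pi * Real.exp (-(Real.pi * |y|))) *
            ((B + ‖H 0‖) * Real.exp (θ * |y|)) := by
            have := Real.pi_pos
            gcongr
        _ = _ := by ring)
    ((i0.sub iK).congr (.of_forall fun y => (hline0 y).symm))
    ((iK.sub i1).congr (.of_forall fun y => (hline1 y).symm))
  simp only [hline0, hline1] at hshift
  rw [integral_sub i0 iK, integral_sub iK i1, integral_mul_const,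
    integral_mellinBarnesKernel hc] at hshift
  linear_combination hshift

theorem Real.one_add_pow_le_mul_exp (k : ℕ) {η : ℝ} (hη : 0 < η) {u : ℝ} (hu : 0 ≤ u) :
    (1 + u) ^ k ≤ k.factorial * Real.exp η / η ^ k * Real.exp (η * u) := by
  have h := Real.pow_div_factorial_le_exp (η * (1 + u)) (by positivity) k
  rw [mul_pow, mul_add, mul_one, Real.exp_add, div_le_iff₀ (by positivity)] at h
  rw [div_mul_eq_mul_div, le_div_iff₀ (by positivity)]
  linarith

theorem Real.rpow_neg_le_pow {r R σ : ℝ} {k : ℕ} (hr : 0 < r) (hR : 1 ≤ R) (h1 : r ≤ R)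
    (h2 : r⁻¹ ≤ R) (hk : |σ| ≤ k) : r ^ (-σ) ≤ R ^ k := by
  have hR0 : 0 ≤ R := zero_le_one.trans hR
  rw [← Real.rpow_natCast]
  rcases le_total 0 σ with h | h
  · rw [Real.rpow_neg hr.le, ← Real.inv_rpow hr.le]
    calc r⁻¹ ^ σ ≤ R ^ σ := Real.rpow_le_rpow (by positivity) h2 h
      _ ≤ R ^ (k : ℝ) := Real.rpow_le_rpow_of_exponent_le hR ((le_abs_self σ).trans hk)
  · calc r ^ (-σ) ≤ R ^ (-σ) := Real.rpow_le_rpow hr.le h1 (by linarith)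
      _ ≤ R ^ (k : ℝ) := Real.rpow_le_rpow_of_exponent_le hR ((neg_le_abs σ).trans hk)

theorem Complex.norm_inv_cpow_le {w s : ℂ} (hw : w ≠ 0) :
    ‖(w ^ s)⁻¹‖ ≤ ‖w‖ ^ (-s.re) * Real.exp (Real.pi * |s.im|) := by
  rw [norm_inv, Complex.norm_cpow_of_ne_zero hw, inv_div, Real.rpow_neg (norm_nonneg _),
    div_eq_inv_mul]
  gcongr ?_ * Real.exp ?_
  calc w.arg * s.im ≤ |w.arg * s.im| := le_abs_self _
    _ ≤ _ := by
      rw [abs_mul]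
      gcongr
      exact Complex.abs_arg_le_pi w

/-- The function `t ↦ (-z)^t / (a+t)^s`, of which the terms of the Lerch series are, up to sign,
the values at the natural numbers. -/
noncomputable def lerchIntegrand (a s z t : ℂ) : ℂ := (-z) ^ t / (a + t) ^ s

theorem differentiableAt_lerchIntegrand {a z : ℂ} (s : ℂ) (hz : z ≠ 0) {t : ℂ}
    (ht : -a.re < t.re) : DifferentiableAt ℂ (lerchIntegrand a s z) t := by
  have hre : 0 < (a + t).re := by simp; linarith
  have hne : a + t ≠ 0 := fun h => by simp [h] at hre
  refine DifferentiableAt.div ?_ ?_ (by simp [Complex.cpow_eq_zero_iff, hne])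
  · exact differentiableAt_id.const_cpow (.inl (neg_ne_zero.2 hz))
  · exact (differentiableAt_id.const_add a).cpow_const (Or.inl hre)

theorem neg_one_pow_mul_lerchIntegrand {a s z : ℂ} (n : ℕ) :
    (-1) ^ n * lerchIntegrand a s z n = z ^ n / (a + n) ^ s := by
  rw [lerchIntegrand, Complex.cpow_natCast, ← mul_div_assoc, ← mul_pow]
  simp

theorem exists_norm_lerchIntegrand_le {a z : ℂ} (s : ℂ) {c : ℝ} (hz0 : z ≠ 0) (hz1 : ‖z‖ < 1)
    (harg : |(-z).arg| < Real.pi) (hc : c ∈ Ioo (-1 : ℝ) 0) (hac : -a.re < c) :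
    ∃ θ : ℝ, 0 ≤ θ ∧ θ < Real.pi ∧ ∃ b : ℕ → ℝ, Summable b ∧
      ∀ n : ℕ, ∀ x ∈ Icc c (c + 1), ∀ y : ℝ,
        ‖lerchIntegrand a s z (n + (x + y * I))‖ ≤ b n * Real.exp (θ * |y|) := by
  set η := (Real.pi - |(-z).arg|) / 2 with hη
  have hη0 : 0 < η := by simp only [hη]; linarith
  obtain ⟨k, hk⟩ := exists_nat_ge |s.re|
  set ε := a.re + c with hε
  have hε0 : 0 < ε := by linarith
  set A := ‖a‖ + 1 + ε⁻¹ with hA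
  have hA1 : 1 ≤ A := by
    have := norm_nonneg a
    have := inv_pos.2 hε0
    linarith
  set M := ‖z‖ ^ c * Real.exp (Real.pi * |s.im|) * A ^ k *
    (k.factorial * Real.exp η / η ^ k) with hM
  have hzn : 0 < ‖z‖ := norm_pos_iff.2 hz0
  refine ⟨|(-z).arg| + η, by positivity, by simp only [hη]; linarith,
    fun n => M * ((n + 1) ^ k * ‖z‖ ^ n), ?_, ?_⟩
  · have h := (summable_nat_add_iff 1).2
      (summable_pow_mul_geometric_of_norm_lt_one k (r := ‖z‖) (by simpa using hz1))
    refine (h.mul_left (M * ‖z‖⁻¹)).congr fun n => ?_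
    rw [pow_succ ‖z‖ n]
    push_cast
    field_simp
  · intro n x hx y
    set w := a + (n + (x + y * I)) with hw
    have hn : (0 : ℝ) ≤ n := n.cast_nonneg
    have hwre : w.re = a.re + (n + x) := by simp [hw]
    have hεw : ε ≤ ‖w‖ := by
      refine le_trans ?_ (Complex.re_le_norm w)
      rw [hwre]
      linarith [hx.1]
    have hw0 : 0 < ‖w‖ := hε0.trans_le hεw
    have hwn : ‖w‖ ≤ ‖a‖ + (n + (1 + |y|)) := by
      refine (norm_add_le _ _).trans (add_le_add le_rfl ((norm_add_le _ _).trans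
        (add_le_add (by simp) ((norm_add_le _ _).trans (add_le_add ?_ (by simp))))))
      rw [Complex.norm_real, Real.norm_eq_abs, abs_le]
      constructor <;> linarith [hx.1, hx.2, hc.1, hc.2]
    have hyn := abs_nonneg y
    have hprod : 1 ≤ (n + 1) * (1 + |y|) := by nlinarith
    have hε' := inv_pos.2 hε0
    set R := A * ((n + 1) * (1 + |y|)) with hR
    have hAR : A ≤ R := le_mul_of_one_le_right (by linarith) hprod
    have ha0 := norm_nonneg a
    have hwR : ‖w‖ ≤ R := by
      have : n + (1 + |y|) ≤ (n + 1) * (1 + |y|) := by nlinarith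
      have : (‖a‖ + 1) * ((n + 1) * (1 + |y|)) ≤ R := by
        exact mul_le_mul_of_nonneg_right (by linarith) (by linarith)
      nlinarith [mul_le_mul_of_nonneg_left hprod ha0]
    have hwR' : ‖w‖⁻¹ ≤ R := by
      have : ‖w‖⁻¹ ≤ ε⁻¹ := by gcongr
      linarith
    have e1 := Real.rpow_neg_le_pow (σ := s.re) hw0 (hA1.trans hAR) hwR hwR' hk
    have e2 := Complex.norm_inv_cpow_le (s := s) (norm_pos_iff.1 hw0)
    have e3 := Real.one_add_pow_le_mul_exp k hη0 hyn
    have e4 : ‖(-z) ^ ((n : ℂ) + (x + y * I))‖ ≤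
        ‖z‖ ^ c * ‖z‖ ^ n * Real.exp (|(-z).arg| * |y|) := by
      rw [Complex.norm_cpow_of_ne_zero (neg_ne_zero.2 hz0), norm_neg, div_eq_mul_inv,
        ← Real.exp_neg, ← Real.rpow_natCast, ← Real.rpow_add hzn]
      gcongr ?_ * Real.exp ?_
      · refine Real.rpow_le_rpow_of_exponent_ge hzn hz1.le ?_
        simp
        linarith [hx.1]
      · rw [← abs_mul]
        simpa using neg_le_abs ((-z).arg * y)
    rw [lerchIntegrand, div_eq_mul_inv, norm_mul, add_mul, Real.exp_add]
    calc _ ≤ (‖z‖ ^ c * ‖z‖ ^ n * Real.exp (|(-z).arg| * |y|)) *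
          (R ^ k * Real.exp (Real.pi * |s.im|)) := by
          gcongr
          refine e2.trans ?_
          gcongr
      _ = ‖z‖ ^ c * ‖z‖ ^ n * Real.exp (|(-z).arg| * |y|) *
          (A ^ k * (n + 1) ^ k * Real.exp (Real.pi * |s.im|)) * (1 + |y|) ^ k := by
          rw [hR, mul_pow, mul_pow]
          ring
      _ ≤ ‖z‖ ^ c * ‖z‖ ^ n * Real.exp (|(-z).arg| * |y|) *
          (A ^ k * (n + 1) ^ k * Real.exp (Real.pi * |s.im|)) *
          (k.factorial * Real.exp η / η ^ k * Real.exp (η * |y|)) := by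
          gcongr
      _ = _ := by
          rw [hM]
          ring

/-- Mellin–Barnes representation of the Lerch transcendent for `|z| < 1`:
for `Re a > 0`, `z ∉ [0,1)` and `max(-Re a, -1) < c < 0`, the integral
`(1/2π) ∫_{-∞}^{∞} Γ(1+c+it) Γ(-c-it) (-z)^(c+it)/(a+c+it)^s dt` converges absolutely
and equals `∑_{n=0}^∞ z^n/(a+n)^s`. -/
theorem lerch_mellinBarnes (a s z : ℂ) (c : ℝ) (ha : 0 < a.re) (hz1 : ‖z‖ < 1)
    (hz2 : ∀ r : ℝ, 0 ≤ r → r < 1 → z ≠ r)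
    (hc1 : max (-a.re) (-1) < c) (hc2 : c < 0) :
    Integrable (fun t : ℝ =>
      Complex.Gamma (1 + ((c : ℂ) + t * I)) * Complex.Gamma (-((c : ℂ) + t * I)) *
        (-z) ^ ((c : ℂ) + t * I) / (a + ((c : ℂ) + t * I)) ^ s) ∧
    (1 / (2 * (Real.pi : ℂ))) *
      ∫ t : ℝ,
        Complex.Gamma (1 + ((c : ℂ) + t * I)) * Complex.Gamma (-((c : ℂ) + t * I)) *
          (-z) ^ ((c : ℂ) + t * I) / (a + ((c : ℂ) + t * I)) ^ s
      = ∑' n : ℕ, z ^ n / (a + n) ^ s := by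
  have hac : -a.re < c := (le_max_left _ _).trans_lt hc1
  have hc : c ∈ Ioo (-1 : ℝ) 0 := ⟨(le_max_right _ _).trans_lt hc1, hc2⟩
  have hz0 : z ≠ 0 := by simpa using hz2 0 le_rfl one_pos
  have harg : |(-z).arg| < Real.pi := by
    refine abs_lt.2 ⟨Complex.neg_pi_lt_arg _, (Complex.arg_le_pi _).lt_of_ne fun h => ?_⟩
    obtain ⟨hre, him⟩ := Complex.arg_eq_pi_iff.1 h
    rw [Complex.neg_re] at hre
    rw [Complex.neg_im] at him
    exact hz2 z.re (by linarith) ((Complex.re_le_norm z).trans_lt hz1)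
      (Complex.ext rfl (by simpa using him))
  obtain ⟨θ, hθ0, hθ, b, hb, hbound⟩ := exists_norm_lerchIntegrand_le s hz0 hz1 harg hc hac
  set J : ℕ → ℂ := fun n => ∫ y : ℝ, mellinBarnesKernel (c + y * I) *
    lerchIntegrand a s z (n + (c + y * I)) with hJ
  have hc0 : c ∈ Icc c (c + 1) := ⟨le_rfl, by linarith⟩
  have hdiff : ∀ n : ℕ, ∀ t : ℂ, -a.re < t.re →
      DifferentiableAt ℂ (fun t => lerchIntegrand a s z (n + t)) t := by
    intro n t ht
    refine (differentiableAt_lerchIntegrand (a := a) s hz0 (t := n + t) ?_).comp t (by fun_prop)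
    simp only [Complex.add_re, Complex.natCast_re]
    linarith [(n.cast_nonneg : (0 : ℝ) ≤ n)]
  have hcont : ∀ n : ℕ, Continuous fun y : ℝ => lerchIntegrand a s z (n + (c + y * I)) := by
    intro n
    refine continuous_iff_continuousAt.2 fun y => ?_
    exact (hdiff n (c + y * I) (by simpa using hac)).continuousAt.comp
      (f := fun y : ℝ => (c : ℂ) + y * I) (by fun_prop)
  have hkey := fun n : ℕ =>
    integrable_mellinBarnesKernel_mul hc (hcont n) hθ (hbound n c hc0)
  have hstep : ∀ n : ℕ, J n + J (n + 1) = 2 * Real.pi * lerchIntegrand a s z n := by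
    intro n
    have h := integral_mellinBarnesKernel_mul_add hc hac (hdiff n) hθ0 hθ (hbound n)
    rw [add_zero] at h
    rw [← h]
    simp only [hJ]
    congr 2
    ext y
    congr 2
    push_cast
    ring
  have hJlim : Tendsto J atTop (𝓝 0) := by
    refine squeeze_zero_norm (fun n => (hkey n).2) ?_
    simpa using hb.tendsto_atTop_zero.const_mul (2 * Real.pi / |Real.sin (Real.pi * c)| *
      ∫ y : ℝ, Real.exp (-((Real.pi - θ) * |y|)))
  have hpart : ∀ N : ℕ, ∑ n ∈ Finset.range N, z ^ n / (a + n) ^ s =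
      1 / (2 * Real.pi) * (J 0 - (-1) ^ N * J N) := by
    intro N
    have hpi : (Real.pi : ℂ) ≠ 0 := Complex.ofReal_ne_zero.2 Real.pi_ne_zero
    induction N with
    | zero => simp
    | succ N ih =>
      rw [Finset.sum_range_succ, ih, ← neg_one_pow_mul_lerchIntegrand]
      have h := hstep N
      field_simp
      rw [pow_succ]
      linear_combination -(-1) ^ N * h
  have hsum : Summable fun n : ℕ => z ^ n / (a + n) ^ s := by
    refine hb.of_norm_bounded fun n => ?_
    rw [← neg_one_pow_mul_lerchIntegrand, norm_mul, norm_pow, norm_neg, norm_one, one_pow,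
      one_mul]
    simpa using hbound n 0 ⟨hc2.le, by linarith [hc.1]⟩ 0
  have hsgn : Tendsto (fun N : ℕ => (-1 : ℂ) ^ N * J N) atTop (𝓝 0) := by
    rw [tendsto_zero_iff_norm_tendsto_zero] at hJlim ⊢
    simpa using hJlim
  have hlim : Tendsto (fun N : ℕ => 1 / (2 * (Real.pi : ℂ)) * (J 0 - (-1) ^ N * J N)) atTop
      (𝓝 (1 / (2 * Real.pi) * J 0)) := by
    simpa using (hsgn.const_sub (J 0)).const_mul (1 / (2 * (Real.pi : ℂ)))
  have hJ0 := tendsto_nhds_unique hlim (hsum.hasSum.tendsto_sum_nat.congr hpart)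
  have hint := (hkey 0).1
  simp only [hJ, Nat.cast_zero, zero_add, lerchIntegrand, mellinBarnesKernel,
    ← mul_div_assoc] at hint hJ0
  exact ⟨hint, hJ0⟩
end

section
/- Let m be a natural number and a a complex number. Then there exists a function f analytic on ℂ ∖ {1} such that f(z) = ∑_{n=0}^∞ (a+n)^m z^n for all |z| < 1 and f(z) = −∑_{n=1}^∞ (a−n)^m z^{−n} for all |z| > 1. -/
open Complex

theorem hasSum_choose_mul_zpow_neg {z : ℂ} (hz : 1 < ‖z‖) (k : ℕ) :
    HasSum (fun n : ℕ => (n.choose k : ℂ) * z ^ (-((n : ℤ) + 1))) (1 / (z - 1) ^ (k + 1)) := by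
  have hz0 : z ≠ 0 := norm_pos_iff.mp (by linarith)
  have hz1 : z - 1 ≠ 0 := sub_ne_zero.mpr (by rintro rfl; simp at hz)
  have hw : ‖z⁻¹‖ < 1 := by simpa using inv_lt_one_of_one_lt₀ hz
  have hvalue : (z⁻¹) ^ (k + 1) * (1 / (1 - z⁻¹) ^ (k + 1)) = 1 / (z - 1) ^ (k + 1) := by
    rw [one_div, ← inv_pow, ← mul_pow, one_div, ← inv_pow, ← mul_inv, mul_sub, mul_one,
      mul_inv_cancel₀ hz0]
  rw [← hvalue, ← (add_left_injective k).hasSum_iff]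
  · refine ((hasSum_choose_mul_geometric_of_norm_lt_one k hw).mul_left _).congr_fun fun n => ?_
    have hpow : z ^ (-(((n + k : ℕ) : ℤ) + 1)) = (z⁻¹) ^ (n + k + 1) := by
      rw [zpow_neg, inv_pow]
      norm_cast
    simp only [Function.comp_apply, hpow]
    ring
  · intro n hn
    have hlt : n < k := by
      by_contra! h
      exact hn ⟨n - k, Nat.sub_add_cancel h⟩
    simp [Nat.choose_eq_zero_of_lt hlt]

/-- The continuation for the coefficients `(x + 1) ⋯ (x + k) / k! * (a + x) ^ m`, whose values at
`x = n` and `x = -(n + 1)` involve `(n + k).choose k` and `(-1) ^ k * n.choose k`. -/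
theorem exists_continuation_choose_mul_pow (a : ℂ) (m k : ℕ) :
    ∃ f : ℂ → ℂ, AnalyticOnNhd ℂ f {(1 : ℂ)}ᶜ ∧
      (∀ z : ℂ, ‖z‖ < 1 →
        HasSum (fun n : ℕ => ((n + k).choose k : ℂ) * (a + n) ^ m * z ^ n) (f z)) ∧
      (∀ z : ℂ, 1 < ‖z‖ →
        HasSum (fun n : ℕ => (-1) ^ k * (n.choose k : ℂ) * (a - ((n : ℂ) + 1)) ^ m *
          z ^ (-((n : ℤ) + 1))) (-f z)) := by
  induction m generalizing k with
  | zero =>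
    refine ⟨fun z => 1 / (1 - z) ^ (k + 1), ?_, fun z hz => ?_, fun z hz => ?_⟩
    · intro z hz
      have hz1 : (1 - z) ^ (k + 1) ≠ 0 := pow_ne_zero _ (sub_ne_zero.mpr (Ne.symm hz))
      exact analyticAt_const.div ((analyticAt_const.sub analyticAt_id).pow _) hz1
    · simpa using hasSum_choose_mul_geometric_of_norm_lt_one k hz
    · have hvalue : (-1) ^ k * (1 / (z - 1) ^ (k + 1)) = -(1 / (1 - z) ^ (k + 1)) := by
        rw [← neg_sub z 1, neg_pow (z - 1), pow_succ (-1 : ℂ)]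
        rcases neg_one_pow_eq_or ℂ k with h | h <;> simp [h]
      rw [← hvalue]
      simpa [mul_assoc] using (hasSum_choose_mul_zpow_neg hz k).mul_left ((-1) ^ k)
  | succ m ih =>
    obtain ⟨f, hf, hf_in, hf_out⟩ := ih k
    obtain ⟨g, hg, hg_in, hg_out⟩ := ih (k + 1)
    refine ⟨fun z => (a - (k + 1)) * f z + (k + 1) * g z, fun z hz =>
      (analyticAt_const.mul (hf z hz)).add (analyticAt_const.mul (hg z hz)),
      fun z hz => ?_, fun z hz => ?_⟩
    · refine (((hf_in z hz).mul_left _).add ((hg_in z hz).mul_left _)).congr_fun fun n => ?_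
      have h : ((n : ℂ) + k + 1) * ((n + k).choose k : ℂ) =
          ((n + (k + 1)).choose (k + 1) : ℂ) * (k + 1) := by
        exact_mod_cast Nat.add_one_mul_choose_eq (n + k) k
      linear_combination (a + n) ^ m * z ^ n * h
    · have hsum := ((hf_out z hz).mul_left (a - (k + 1))).add ((hg_out z hz).mul_left ((k : ℂ) + 1))
      rw [show -((a - (k + 1)) * f z + (k + 1) * g z) =
        (a - (k + 1)) * -f z + (k + 1) * -g z by ring]
      refine hsum.congr_fun fun n => ?_
      have h : (n.choose (k + 1) : ℂ) * (k + 1) = (n.choose k : ℂ) * (n - k) := by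
        rcases le_or_gt k n with hkn | hkn
        · rw [← Nat.cast_sub hkn]
          exact_mod_cast Nat.choose_succ_right_eq n k
        · simp [Nat.choose_eq_zero_of_lt hkn, Nat.choose_eq_zero_of_lt (hkn.trans k.lt_succ_self)]
      linear_combination
        (-1) ^ k * (a - ((n : ℂ) + 1)) ^ m * z ^ (-((n : ℤ) + 1)) * h

/-- For `s = -m` a non-positive integer, the Lerch transcendent
`Φ(z,-m,a)` extends to a function analytic on `ℂ \ {1}` whose value for `|z| < 1` is
`∑_{n=0}^∞ (a+n)^m z^n` and for `|z| > 1` is `-∑_{n=1}^∞ (a-n)^m z^(-n)`. -/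
theorem lerch_nonpositive_integer_continuation (m : ℕ) (a : ℂ) :
    ∃ f : ℂ → ℂ, AnalyticOnNhd ℂ f {(1 : ℂ)}ᶜ ∧
      (∀ z : ℂ, ‖z‖ < 1 → HasSum (fun n : ℕ => (a + n) ^ m * z ^ n) (f z)) ∧
      (∀ z : ℂ, 1 < ‖z‖ →
        HasSum (fun n : ℕ => (a - ((n : ℂ) + 1)) ^ m * z ^ (-((n : ℤ) + 1))) (-f z)) := by
  simpa using exists_continuation_choose_mul_pow a m 0
end

section
/- Let n be a natural number and s a complex number with Re s < 1. Then lim_{x→∞, x real} x^{n+1−s} ∫₀^∞ e^{−xτ} τ^{−s} (1 − e^{−τ})^n dτ = Γ(n+1−s). In particular the integrals for n = 0, 1, 2, … form an asymptotic sequence as x → ∞, the n-th being asymptotic to Γ(n−s+1) x^{s−n−1}. -/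
open Complex MeasureTheory Set Filter Topology

/-- The scaled difference `x (1 - e^{-u/x})` tends to `u` as real `x → ∞`. -/
lemma tendsto_mul_one_sub_exp_neg_div (u : ℝ) :
    Tendsto (fun x : ℝ => x * (1 - Real.exp (-(u / x)))) atTop (𝓝 u) := by
  have hd : HasDerivAt (fun t : ℝ => 1 - Real.exp (-(u * t))) u 0 := by
    have h := (((hasDerivAt_id (0 : ℝ)).const_mul u).neg.exp).const_sub 1
    simpa using h
  have h := (hasDerivAt_iff_tendsto_slope_zero.1 hd).mono_left
    (nhdsWithin_mono 0 fun t (ht : 0 < t) => ht.ne')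
  refine (h.comp tendsto_inv_atTop_nhdsGT_zero).congr fun x => ?_
  simp [div_eq_mul_inv]

/-- For `x > 0` and `u ≥ 0`, the scaled difference `x (1 - e^{-u/x})` lies in `[0, u]`. -/
lemma mul_one_sub_exp_neg_div_mem_Icc {x u : ℝ} (hx : 0 < x) (hu : 0 ≤ u) :
    x * (1 - Real.exp (-(u / x))) ∈ Icc 0 u := by
  have h₁ : Real.exp (-(u / x)) ≤ 1 := Real.exp_le_one_iff.2 (by simpa using by positivity)
  have h₂ := Real.add_one_le_exp (-(u / x))
  refine ⟨mul_nonneg hx.le (by linarith), ?_⟩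
  calc x * (1 - Real.exp (-(u / x))) ≤ x * (u / x) := by gcongr; linarith
    _ = u := by field_simp

/-- The substitution `u = x τ` in the integral `∫₀^∞ e^{-xτ} τ^{-s} (1-e^{-τ})^n dτ`. -/
lemma cpow_mul_integral_exp_mul_one_sub_exp_pow (n : ℕ) (s : ℂ) {x : ℝ} (hx : 0 < x) :
    (x : ℂ) ^ ((n : ℂ) + 1 - s) *
        ∫ τ in Ioi (0 : ℝ),
          Complex.exp (-(x : ℂ) * τ) * (τ : ℂ) ^ (-s) * (1 - Complex.exp (-(τ : ℂ))) ^ n =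
      ∫ u in Ioi (0 : ℝ), (Real.exp (-u) : ℂ) * (u : ℂ) ^ (-s) *
        ((x * (1 - Real.exp (-(u / x))) : ℝ) : ℂ) ^ n := by
  have hx₀ : (x : ℂ) ≠ 0 := by exact_mod_cast hx.ne'
  have h := integral_comp_mul_left_Ioi (fun u : ℝ => (Real.exp (-u) : ℂ) * (u : ℂ) ^ (-s) *
    ((x * (1 - Real.exp (-(u / x))) : ℝ) : ℂ) ^ n) 0 hx
  rw [mul_zero, eq_inv_smul_iff₀ hx.ne'] at h
  rw [← h, ← integral_const_mul, ← integral_smul]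
  refine setIntegral_congr_fun measurableSet_Ioi fun τ (hτ : 0 < τ) => ?_
  have hdiv : x * τ / x = τ := by field_simp
  have hpow : (x : ℂ) ^ ((n : ℂ) + 1 - s) = x * x ^ n * (x : ℂ) ^ (-s) := by
    rw [sub_eq_add_neg, cpow_add _ _ hx₀, cpow_add _ _ hx₀, cpow_natCast, cpow_one]
    ring
  simp only [hdiv, hpow, real_smul]
  push_cast
  rw [mul_cpow_ofReal_nonneg hx.le hτ.le, mul_pow, neg_mul]
  ring

/-- For `Re s < 1` and each fixed `n`, as real `x → ∞`,
`∫₀^∞ e^{-xτ} τ^{-s} (1-e^{-τ})^n dτ ∼ Γ(n+1-s) x^{s-n-1}`, i.e.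
`x^{n+1-s} ∫₀^∞ e^{-xτ} τ^{-s} (1-e^{-τ})^n dτ → Γ(n+1-s)`. -/
theorem pn_asymptotics (n : ℕ) (s : ℂ) (hs : s.re < 1) :
    Tendsto (fun x : ℝ =>
        (x : ℂ) ^ ((n : ℂ) + 1 - s) *
          ∫ τ in Ioi (0 : ℝ),
            Complex.exp (-(x : ℂ) * τ) * (τ : ℂ) ^ (-s) * (1 - Complex.exp (-(τ : ℂ))) ^ n)
      atTop (𝓝 (Complex.Gamma ((n : ℂ) + 1 - s))) := by
  have hre : 0 < ((n : ℂ) + 1 - s).re := by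
    simp only [sub_re, add_re, natCast_re, one_re]
    linarith [n.cast_nonneg (α := ℝ)]
  have hGamma : ∀ u ∈ Ioi (0 : ℝ), (Real.exp (-u) : ℂ) * (u : ℂ) ^ ((n : ℂ) + 1 - s - 1) =
      (Real.exp (-u) : ℂ) * (u : ℂ) ^ (-s) * (u : ℂ) ^ n := by
    intro u hu
    have hu₀ : (u : ℂ) ≠ 0 := by exact_mod_cast (ne_of_gt hu)
    rw [show (n : ℂ) + 1 - s - 1 = -s + n by ring, cpow_add _ _ hu₀, cpow_natCast, mul_assoc]
  have hint := (integrableOn_congr_fun hGamma measurableSet_Ioi).1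
    (Complex.GammaIntegral_convergent hre)
  rw [Complex.Gamma_eq_integral hre, Complex.GammaIntegral,
    setIntegral_congr_fun measurableSet_Ioi hGamma]
  refine Tendsto.congr' ((eventually_gt_atTop 0).mono fun x hx =>
    (cpow_mul_integral_exp_mul_one_sub_exp_pow n s hx).symm) ?_
  refine tendsto_integral_filter_of_dominated_convergence _ ?_ ?_ hint.norm ?_
  · refine Eventually.of_forall fun x => Measurable.aestronglyMeasurable ?_
    fun_prop
  · filter_upwards [eventually_gt_atTop 0] with x hx
    filter_upwards [ae_restrict_mem measurableSet_Ioi] with u hu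
    obtain ⟨h₀, h₁⟩ := mul_one_sub_exp_neg_div_mem_Icc hx (le_of_lt hu)
    rw [norm_mul, norm_mul _ ((u : ℂ) ^ n), norm_pow, norm_pow, norm_real, Real.norm_of_nonneg h₀,
      norm_real, Real.norm_of_nonneg (le_of_lt hu)]
    gcongr
  · exact Eventually.of_forall fun u => Tendsto.const_mul _
      (((continuous_ofReal.tendsto u).comp (tendsto_mul_one_sub_exp_neg_div u)).pow n)
end
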